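/- arXiv:1209.5614 — 4 statements merged into one kernel-verified Lean document; each statement's English description precedes it below -/
import Mathlib

section
/- Let H be a connected m-multigraph on n vertices with at least one edge, m ≥ 2, and let λ_0 = max{ A_H x^m : x ∈ ℝ^n, x_i ≥ 0 for all i, Σ_{i=1}^n x_i^m = 1 }. If (λ, x) is an H-eigenpair of A_H in which every coordinate of x is strictly positive, then λ = λ_0, and any two such strictly positive H-eigenvectors are positive scalar multiples of each other. -/
open Finset

noncomputable section

/-- Prepend the vertex `i` to the `(m-1)`-tuple `j`, producing an `m`-tuple
`(i, j 0, j 1, ...)` of indices. -/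
def consVec {n m : ℕ} (i : Fin n) (j : Fin (m - 1) → Fin n) : Fin m → Fin n :=
  fun t => if h : (t : ℕ) = 0 then i else j ⟨(t : ℕ) - 1, by have := t.isLt; omega⟩

/-- The `i`-th entry of the vector `A x^{m-1}`:
`∑_{i_2,…,i_m} a_{i i_2 … i_m} x_{i_2} ⋯ x_{i_m}` (real version). -/
def tContract {n m : ℕ} (A : (Fin m → Fin n) → ℝ) (x : Fin n → ℝ) (i : Fin n) : ℝ :=
  ∑ j : Fin (m - 1) → Fin n, A (consVec i j) * ∏ t, x (j t)

/-- The `i`-th entry of the vector `A x^{m-1}` (complex vector, real tensor). -/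
def tContractC {n m : ℕ} (A : (Fin m → Fin n) → ℝ) (x : Fin n → ℂ) (i : Fin n) : ℂ :=
  ∑ j : Fin (m - 1) → Fin n, (A (consVec i j) : ℂ) * ∏ t, x (j t)

/-- The scalar `A x^m = ∑_{i_1,…,i_m} a_{i_1 … i_m} x_{i_1} ⋯ x_{i_m}`. -/
def tForm {n m : ℕ} (A : (Fin m → Fin n) → ℝ) (x : Fin n → ℝ) : ℝ :=
  ∑ j : Fin m → Fin n, A j * ∏ t, x (j t)

/-- The adjacency tensor of an `m`-multigraph on `n` vertices whose edge multiset is `E`: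
the entry at `(i_1,…,i_m)` is `1/(m-1)!` if the multiset `{i_1,…,i_m}` is an edge, else `0`. -/
def adjT (n m : ℕ) (E : Multiset (Multiset (Fin n))) : (Fin m → Fin n) → ℝ :=
  fun j => if (↑(List.ofFn j) : Multiset (Fin n)) ∈ E then
    1 / (Nat.factorial (m - 1) : ℝ) else 0

/-- The adjacency tensor of an `m`-graph on `n` vertices whose edge set is `E`:
the entry at `(i_1,…,i_m)` is `1/(m-1)!` if `i_1,…,i_m` are pairwise distinct and the set
`{i_1,…,i_m}` is an edge, else `0`. -/
def adjTG (n m : ℕ) (E : Finset (Finset (Fin n))) : (Fin m → Fin n) → ℝ :=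
  fun j => if (List.ofFn j).Nodup ∧ (List.ofFn j).toFinset ∈ E then
    1 / (Nat.factorial (m - 1) : ℝ) else 0

/-- Degree of a vertex in a multi-hypergraph: the number of edges containing it
(counted with multiplicity). -/
def degM {n : ℕ} (E : Multiset (Multiset (Fin n))) (v : Fin n) : ℕ :=
  Multiset.card (E.filter (fun e => v ∈ e))

/-- Degree of a vertex in a hypergraph: the number of edges containing it. -/
def degG {n : ℕ} (E : Finset (Finset (Fin n))) (v : Fin n) : ℕ :=
  (E.filter (fun e => v ∈ e)).card

/-- A multi-hypergraph is connected iff every pair of vertices is joined by a chain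
`(x_1, E_1, x_2, E_2, …, E_q, x_{q+1})` with `x_1,…,x_q` distinct vertices,
`E_1,…,E_q` distinct edges, and `x_k, x_{k+1} ∈ E_k` for all `k`. -/
def IsConnectedM {n : ℕ} (E : Multiset (Multiset (Fin n))) : Prop :=
  ∀ u v : Fin n, ∃ (q : ℕ) (x : Fin (q + 1) → Fin n) (ed : Fin q → Multiset (Fin n)),
    x 0 = u ∧ x (Fin.last q) = v ∧
    (∀ k1 k2 : Fin q, k1 ≠ k2 → x k1.castSucc ≠ x k2.castSucc) ∧
    (∀ k1 k2 : Fin q, k1 ≠ k2 → ed k1 ≠ ed k2) ∧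
    (∀ k : Fin q, ed k ∈ E) ∧
    (∀ k : Fin q, x k.castSucc ∈ ed k ∧ x k.succ ∈ ed k)

/-- A nonnegative tensor is weakly irreducible iff its associated directed graph
(with an arc `i → j` whenever `a_{i i_2 … i_m} > 0` for some `i_2,…,i_m` with
`j ∈ {i_2,…,i_m}`) is strongly connected. -/
def WeaklyIrreducible {n m : ℕ} (A : (Fin m → Fin n) → ℝ) : Prop :=
  ∀ i j : Fin n, Relation.ReflTransGen
    (fun a b => ∃ v : Fin (m - 1) → Fin n, (∃ t, v t = b) ∧ 0 < A (consVec a v)) i j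

/-- An `m`-multigraph is nicely-connected iff there is no nonempty proper vertex subset `V₀`
such that no edge has the form `{i, i_2, …, i_m}` with `i ∈ V₀` and `i_2, …, i_m ∉ V₀`. -/
def NicelyConnectedM (n m : ℕ) (E : Multiset (Multiset (Fin n))) : Prop :=
  ¬ ∃ V0 : Finset (Fin n), V0.Nonempty ∧ V0 ≠ Finset.univ ∧
      ∀ (i : Fin n) (j : Fin (m - 1) → Fin n), i ∈ V0 → (∀ t, j t ∉ V0) →
        (i ::ₘ (↑(List.ofFn j) : Multiset (Fin n))) ∉ E

/-- An `m`-graph is nicely-connected iff there is no nonempty vertex subset `V₀` with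
`|V₀| ≤ n - m + 1` such that no edge has the form `{i, i_2, …, i_m}` with `i ∈ V₀` and
`i_2, …, i_m ∉ V₀`. -/
def NicelyConnectedG (n m : ℕ) (E : Finset (Finset (Fin n))) : Prop :=
  ¬ ∃ V0 : Finset (Fin n), V0.Nonempty ∧ V0.card ≤ n - m + 1 ∧
      ∀ (i : Fin n) (j : Fin (m - 1) → Fin n), i ∈ V0 → (∀ t, j t ∉ V0) →
        insert i (List.ofFn j).toFinset ∉ E

/-- A tensor is irreducible iff there is no nonempty proper index subset `I` with
`a_{i_1 i_2 … i_m} = 0` for all `i_1 ∈ I` and `i_2, …, i_m ∉ I`. -/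
def TIrreducible {n m : ℕ} (A : (Fin m → Fin n) → ℝ) : Prop :=
  ¬ ∃ I : Finset (Fin n), I.Nonempty ∧ I ≠ Finset.univ ∧
      ∀ (i : Fin n) (j : Fin (m - 1) → Fin n), i ∈ I → (∀ t, j t ∉ I) →
        A (consVec i j) = 0
lemma consVec_succ {n k : ℕ} (i : Fin n) (j : Fin k → Fin n) :
    consVec (m := k + 1) i j = Fin.cons i j := by
  funext t
  refine Fin.cases ?_ (fun s => ?_) t
  · simp [consVec]
  · simp only [consVec, Fin.val_succ, Nat.add_one_ne_zero, dite_false, Fin.cons_succ]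
    rfl

lemma sum_mul_tContract {n m : ℕ} (hm : 0 < m) (A : (Fin m → Fin n) → ℝ) (x w : Fin n → ℝ) :
    ∑ i, w i * (x i * tContract A x i) =
      ∑ j : Fin m → Fin n, A j * (∏ t, x (j t)) * w (j ⟨0, hm⟩) := by
  obtain ⟨k, rfl⟩ : ∃ k, m = k + 1 := ⟨m - 1, by omega⟩
  rw [← (Fin.consEquiv fun _ : Fin (k + 1) => Fin n).sum_comp, Fintype.sum_prod_type]
  refine Finset.sum_congr rfl fun i _ => ?_
  simp only [tContract, Finset.mul_sum]
  refine Finset.sum_congr rfl fun (j : Fin k → Fin n) _ => ?_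
  rw [consVec_succ]
  simp only [Fin.consEquiv, Equiv.coe_fn_mk, Fin.prod_univ_succ, Fin.cons_zero, Fin.cons_succ,
    Fin.mk_zero']
  ring_nf
  rfl

lemma tForm_eq_sum_mul_tContract {n m : ℕ} (hm : 0 < m) (A : (Fin m → Fin n) → ℝ)
    (x : Fin n → ℝ) : tForm A x = ∑ i, x i * tContract A x i := by
  simpa [tForm] using (sum_mul_tContract hm A x fun _ => 1).symm

lemma adjT_nonneg {n m : ℕ} (E : Multiset (Multiset (Fin n))) (j : Fin m → Fin n) :
    0 ≤ adjT n m E j := by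
  unfold adjT
  split_ifs <;> positivity

lemma adjT_comp_perm {n m : ℕ} (E : Multiset (Multiset (Fin n))) (σ : Equiv.Perm (Fin m))
    (j : Fin m → Fin n) : adjT n m E (j ∘ σ) = adjT n m E j := by
  simp only [adjT, Multiset.coe_eq_coe.2 (σ.ofFn_comp_perm j)]

lemma weaklyIrreducible_adjT {n m : ℕ} (hm : 0 < m) {E : Multiset (Multiset (Fin n))}
    (hE : ∀ e ∈ E, Multiset.card e = m) (hconn : IsConnectedM E) :
    WeaklyIrreducible (adjT n m E) := by
  intro u v
  obtain ⟨q, x, ed, rfl, rfl, -, -, hed, hx⟩ := hconn u v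
  suffices h : ∀ k : Fin (q + 1), Relation.ReflTransGen _ (x 0) (x k) from h _
  refine Fin.induction .refl fun k ih => ih.trans ?_
  obtain ⟨ha, hb⟩ := hx k
  generalize x k.castSucc = a at *
  generalize x k.succ = b at *
  obtain rfl | hab := eq_or_ne b a
  · exact .refl
  obtain ⟨s, hs⟩ := Multiset.exists_cons_of_mem ha
  have hcard := hE _ (hed k)
  obtain ⟨l, rfl⟩ : ∃ l : List (Fin n), (l : Multiset (Fin n)) = s := Quot.exists_rep s
  obtain ⟨r, rfl⟩ : ∃ r, m = r + 1 := ⟨m - 1, by omega⟩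
  have hl : l.length = r := by simpa [hs] using hcard
  subst hl
  have hbl : b ∈ l := by simpa [hs, hab] using hb
  obtain ⟨t, ht⟩ := List.mem_iff_get.1 hbl
  refine .single ⟨l.get, ⟨t, ht⟩, ?_⟩
  have hmem : ((a :: l : List (Fin n)) : Multiset (Fin n)) ∈ E := by
    simpa [hs] using hed k
  rw [consVec_succ]
  simp only [adjT, List.ofFn_cons, List.ofFn_get, hmem, if_true]
  positivity

/-- A positive eigenvector controls the form of a symmetric nonnegative tensor. -/
lemma tForm_le_of_pos_eigenvector {n m : ℕ} (hm : 0 < m) {A : (Fin m → Fin n) → ℝ}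
    (hA : ∀ j, 0 ≤ A j) (hsymm : ∀ (σ : Equiv.Perm (Fin m)) j, A (j ∘ σ) = A j)
    {lam : ℝ} {x : Fin n → ℝ} (hx : ∀ i, 0 < x i)
    (hex : ∀ i, tContract A x i = lam * x i ^ (m - 1))
    {y : Fin n → ℝ} (hy : ∀ i, 0 ≤ y i) : tForm A y ≤ lam * ∑ i, y i ^ m := by
  set z : Fin n → ℝ := fun i => y i / x i with hz
  have hz0 : ∀ i, 0 ≤ z i := fun i => div_nonneg (hy i) (hx i).le
  have hyz : ∀ i, y i = x i * z i := fun i => by simp [hz, mul_div_cancel₀ _ (hx i).ne']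
  have hmR : (0 : ℝ) < m := by exact_mod_cast hm
  have amgm : ∀ j : Fin m → Fin n, ∏ t, z (j t) ≤ ∑ t, (m : ℝ)⁻¹ * z (j t) ^ m := fun j => by
    have h := Real.geom_mean_le_arith_mean_weighted Finset.univ (fun _ : Fin m => (m : ℝ)⁻¹)
      (fun t => z (j t) ^ m) (fun _ _ => by positivity) (by simp [hmR.ne'])
      (fun t _ => pow_nonneg (hz0 _) _)
    simpa only [Real.pow_rpow_inv_natCast (hz0 _) hm.ne'] using h
  have hswap : ∀ t : Fin m, ∑ j : Fin m → Fin n, A j * (∏ s, x (j s)) * z (j t) ^ m =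
      ∑ j : Fin m → Fin n, A j * (∏ s, x (j s)) * z (j ⟨0, hm⟩) ^ m := fun t => by
    let σ : Equiv.Perm (Fin m) := Equiv.swap ⟨0, hm⟩ t
    rw [← (σ.arrowCongr (Equiv.refl (Fin n))).sum_comp]
    refine Finset.sum_congr rfl fun j _ => ?_
    have hj : σ.arrowCongr (Equiv.refl (Fin n)) j = j ∘ σ := by
      ext s; simp [σ, Equiv.arrowCongr]
    rw [hj, hsymm, Function.comp_apply, Equiv.swap_apply_right]
    simp only [Function.comp_apply]
    rw [Equiv.prod_comp σ fun s => x (j s)]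
  calc tForm A y = ∑ j : Fin m → Fin n, A j * (∏ t, x (j t)) * ∏ t, z (j t) := by
        simp only [tForm, hyz, Finset.prod_mul_distrib, mul_assoc]
    _ ≤ ∑ j : Fin m → Fin n, A j * (∏ t, x (j t)) * ∑ t, (m : ℝ)⁻¹ * z (j t) ^ m :=
        Finset.sum_le_sum fun j _ => mul_le_mul_of_nonneg_left (amgm j)
          (mul_nonneg (hA j) (Finset.prod_nonneg fun t _ => (hx _).le))
    _ = ∑ t : Fin m, (m : ℝ)⁻¹ * ∑ j : Fin m → Fin n, A j * (∏ s, x (j s)) * z (j t) ^ m := by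
        simp only [Finset.mul_sum]
        rw [Finset.sum_comm]
        exact Finset.sum_congr rfl fun _ _ => Finset.sum_congr rfl fun _ _ => by ring
    _ = ∑ j : Fin m → Fin n, A j * (∏ s, x (j s)) * z (j ⟨0, hm⟩) ^ m := by
        simp [hswap, hmR.ne']
    _ = lam * ∑ i, y i ^ m := by
        rw [← sum_mul_tContract hm A x fun i => z i ^ m, Finset.mul_sum]
        refine Finset.sum_congr rfl fun i _ => ?_
        rw [hex, hyz, mul_pow, ← mul_pow_sub_one hm.ne' (x i)]
        ring

lemma tForm_eq_of_eigenvector {n m : ℕ} (hm : 0 < m) {A : (Fin m → Fin n) → ℝ}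
    {lam : ℝ} {x : Fin n → ℝ} (hex : ∀ i, tContract A x i = lam * x i ^ (m - 1)) :
    tForm A x = lam * ∑ i, x i ^ m := by
  rw [tForm_eq_sum_mul_tContract hm, Finset.mul_sum]
  refine Finset.sum_congr rfl fun i _ => ?_
  rw [hex, ← mul_pow_sub_one hm.ne' (x i)]
  ring

lemma tForm_smul {n m : ℕ} (A : (Fin m → Fin n) → ℝ) (c : ℝ) (x : Fin n → ℝ) :
    tForm A (fun i => c * x i) = c ^ m * tForm A x := by
  simp only [tForm, Finset.prod_mul_distrib, Finset.prod_const, Finset.card_univ,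
    Fintype.card_fin, Finset.mul_sum]
  exact Finset.sum_congr rfl fun _ _ => by ring

/-- The eigenvalue of a positive eigenvector is the maximum of the form on the positive part of
the unit sphere of the `ℓ^m` norm. -/
lemma isGreatest_of_pos_eigenvector {n m : ℕ} [NeZero n] (hm : 0 < m) {A : (Fin m → Fin n) → ℝ}
    (hA : ∀ j, 0 ≤ A j) (hsymm : ∀ (σ : Equiv.Perm (Fin m)) j, A (j ∘ σ) = A j)
    {lam : ℝ} {x : Fin n → ℝ} (hx : ∀ i, 0 < x i)
    (hex : ∀ i, tContract A x i = lam * x i ^ (m - 1)) :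
    IsGreatest {r : ℝ | ∃ y : Fin n → ℝ, (∀ i, 0 ≤ y i) ∧ (∑ i, y i ^ m = 1) ∧
      tForm A y = r} lam := by
  constructor
  · have hS : 0 < ∑ i, x i ^ m :=
      Finset.sum_pos (fun i _ => pow_pos (hx i) m) Finset.univ_nonempty
    set S := ∑ i, x i ^ m with hSdef
    set c : ℝ := S⁻¹ ^ ((m : ℝ)⁻¹)
    have hc : c ^ m = S⁻¹ := Real.rpow_inv_natCast_pow (by positivity) hm.ne'
    refine ⟨fun i => c * x i, fun i => mul_nonneg (by positivity) (hx i).le, ?_, ?_⟩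
    · simp only [mul_pow, ← Finset.mul_sum, hc]
      exact inv_mul_cancel₀ hS.ne'
    · rw [tForm_smul, tForm_eq_of_eigenvector hm hex, hc, ← hSdef]
      field_simp
  · rintro r ⟨y, hy, hsum, rfl⟩
    simpa [hsum] using tForm_le_of_pos_eigenvector hm hA hsymm hx hex hy

/-- Two positive eigenvectors of a weakly irreducible nonnegative tensor with the same eigenvalue
are proportional. -/
lemma exists_pos_smul_of_pos_eigenvector {n m : ℕ} [NeZero n] {A : (Fin m → Fin n) → ℝ}
    (hA : ∀ j, 0 ≤ A j) (hirr : WeaklyIrreducible A) {lam : ℝ} {x y : Fin n → ℝ}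
    (hx : ∀ i, 0 < x i) (hy : ∀ i, 0 < y i)
    (hex : ∀ i, tContract A x i = lam * x i ^ (m - 1))
    (hey : ∀ i, tContract A y i = lam * y i ^ (m - 1)) :
    ∃ c : ℝ, 0 < c ∧ ∀ i, y i = c * x i := by
  obtain ⟨i₀, hi₀⟩ := Finite.exists_max fun i => y i / x i
  set c := y i₀ / x i₀
  have hc : 0 < c := div_pos (hy _) (hx _)
  have hle : ∀ i, y i ≤ c * x i := fun i => (div_le_iff₀ (hx i)).1 (hi₀ i)
  refine ⟨c, hc, fun i => ?_⟩
  induction hirr i₀ i with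
  | refl => exact (div_mul_cancel₀ _ (hx i₀).ne').symm
  | @tail a _ _ hab ih =>
    obtain ⟨v, ⟨t, rfl⟩, hv⟩ := hab
    have hsum : ∑ j : Fin (m - 1) → Fin n, A (consVec a j) * ∏ t, y (j t) =
        ∑ j : Fin (m - 1) → Fin n, A (consVec a j) * ∏ t, c * x (j t) := by
      have h : c ^ (m - 1) * tContract A x a = tContract A y a := by
        rw [hex, hey, ih, mul_pow]; ring
      rw [tContract, tContract, Finset.mul_sum] at h
      rw [← h]
      refine Finset.sum_congr rfl fun j _ => ?_
      rw [Finset.prod_mul_distrib, Finset.prod_const, Finset.card_univ, Fintype.card_fin]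
      ring
    have hterm := (Finset.sum_eq_sum_iff_of_le fun j _ => mul_le_mul_of_nonneg_left
      (Finset.prod_le_prod (fun t _ => (hy (j t)).le) fun t _ => hle (j t)) (hA _)).1 hsum v
      (Finset.mem_univ _)
    have hprod := mul_left_cancel₀ hv.ne' hterm
    by_contra hne
    exact (Finset.prod_lt_prod (fun s _ => hy (v s)) (fun s _ => hle (v s))
      ⟨t, Finset.mem_univ _, (hle _).lt_of_ne hne⟩).ne hprod

/-- For a connected m-multigraph with at least one edge, any H-eigenpair with a
strictly positive eigenvector has eigenvalue λ₀ = max{A_H x^m : x ≥ 0, Σ x_i^m = 1},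
and any two strictly positive H-eigenvectors are positive multiples of each other. -/
theorem stmt2 (n m : ℕ) (hm : 2 ≤ m) (E : Multiset (Multiset (Fin n)))
    (hE : ∀ e ∈ E, Multiset.card e = m) (hne : E ≠ 0) (hconn : IsConnectedM E)
    (lam0 : ℝ)
    (hlam0 : IsGreatest {r : ℝ | ∃ y : Fin n → ℝ, (∀ i, 0 ≤ y i) ∧ (∑ i, (y i) ^ m = 1) ∧
      tForm (adjT n m E) y = r} lam0)
    (lam mu : ℝ) (x y : Fin n → ℝ)
    (hx : ∀ i, 0 < x i) (hy : ∀ i, 0 < y i)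
    (hex : ∀ i, tContract (adjT n m E) x i = lam * (x i) ^ (m - 1))
    (hey : ∀ i, tContract (adjT n m E) y i = mu * (y i) ^ (m - 1)) :
    lam = lam0 ∧ ∃ c : ℝ, 0 < c ∧ ∀ i, y i = c * x i := by
  obtain ⟨e, he⟩ := Multiset.exists_mem_of_ne_zero hne
  have hm0 : 0 < m := by omega
  obtain ⟨v, -⟩ := Multiset.card_pos_iff_exists_mem.1 ((hE e he).symm ▸ hm0)
  have : NeZero n := ⟨v.pos.ne'⟩
  have hlam : lam = lam0 := (isGreatest_of_pos_eigenvector hm0 (adjT_nonneg E)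
    (adjT_comp_perm E) hx hex).unique hlam0
  have hmu : mu = lam0 := (isGreatest_of_pos_eigenvector hm0 (adjT_nonneg E)
    (adjT_comp_perm E) hy hey).unique hlam0
  subst hlam hmu
  exact ⟨rfl, exists_pos_smul_of_pos_eigenvector (adjT_nonneg E)
    (weaklyIrreducible_adjT hm0 hE hconn) hx hy hex hey⟩
end
end

section
/- Let H be an m-multigraph on n vertices, m ≥ 2, which is nicely-connected. Then every Z-eigenpair (λ, x) of the adjacency tensor A_H with λ > 0 and every coordinate of x nonnegative must satisfy x_i > 0 for all 1 ≤ i ≤ n. -/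
open Finset

noncomputable section

lemma coe_ofFn_consVec {n m : ℕ} (hm : 1 ≤ m) (i : Fin n) (j : Fin (m - 1) → Fin n) :
    (↑(List.ofFn (consVec i j)) : Multiset (Fin n)) = i ::ₘ ↑(List.ofFn j) := by
  obtain ⟨k, rfl⟩ := Nat.exists_eq_add_of_le' hm
  rw [List.ofFn_succ, Multiset.cons_coe]
  simp [consVec]

lemma adjT_pos {n m : ℕ} {E : Multiset (Multiset (Fin n))} {j : Fin m → Fin n}
    (hj : (↑(List.ofFn j) : Multiset (Fin n)) ∈ E) : 0 < adjT n m E j := by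
  rw [adjT, if_pos hj]
  positivity

lemma tContract_pos {n m : ℕ} {A : (Fin m → Fin n) → ℝ} (hA : ∀ j, 0 ≤ A j)
    {x : Fin n → ℝ} (hx : ∀ i, 0 ≤ x i) {i : Fin n} {j : Fin (m - 1) → Fin n}
    (hij : 0 < A (consVec i j)) (hj : ∀ t, 0 < x (j t)) : 0 < tContract A x i :=
  Finset.sum_pos' (fun k _ => mul_nonneg (hA _) (Finset.prod_nonneg fun t _ => hx (k t)))
    ⟨j, Finset.mem_univ j, mul_pos hij (Finset.prod_pos fun t _ => hj t)⟩

/-- In a nicely-connected m-multigraph, every Z-eigenpair (λ, x) of A_H with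
λ > 0 and x nonnegative has all coordinates of x strictly positive. -/
theorem stmt5 (n m : ℕ) (hm : 2 ≤ m) (E : Multiset (Multiset (Fin n)))
    (hE : ∀ e ∈ E, Multiset.card e = m) (hnc : NicelyConnectedM n m E)
    (lam : ℝ) (x : Fin n → ℝ) (hlam : 0 < lam) (hx : ∀ i, 0 ≤ x i)
    (heig : ∀ i, tContract (adjT n m E) x i = lam * x i)
    (hnorm : ∑ i, (x i) ^ 2 = 1) :
    ∀ i, 0 < x i := by
  by_contra! h
  obtain ⟨i₀, hi₀⟩ := h
  refine hnc ⟨Finset.univ.filter (fun i => x i = 0), ⟨i₀, ?_⟩, fun h => ?_,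
    fun i j hi hj hedge => ?_⟩
  · simpa using le_antisymm hi₀ (hx i₀)
  · have hx0 : ∀ i, x i = 0 := by simpa [Finset.filter_eq_self] using h
    simp [hx0] at hnorm
  · have hxi : x i = 0 := by simpa using hi
    have hxj : ∀ t, 0 < x (j t) := fun t =>
      (hx _).lt_of_ne' (by simpa using hj t)
    rw [← coe_ofFn_consVec (by lia)] at hedge
    have hpos := tContract_pos (adjT_nonneg E) hx (adjT_pos hedge) hxj
    simp [heig, hxi] at hpos
end
end

section
/- Let H be an m-graph on n vertices, 2 ≤ m ≤ n, which is m-complete. Then every Z-eigenpair (λ, x) of the adjacency tensor A_H with λ > 0 and every coordinate of x nonnegative must satisfy x_i > 0 for all 1 ≤ i ≤ n. -/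
open Finset

noncomputable section

theorem consVec_injective_iff {n m : ℕ} (hm : 0 < m) (i : Fin n) (j : Fin (m - 1) → Fin n) :
    Function.Injective (consVec (m := m) i j) ↔ Function.Injective j ∧ ∀ t, j t ≠ i := by
  obtain ⟨m, rfl⟩ : ∃ k, m = k + 1 := ⟨m - 1, by omega⟩
  have h : consVec (m := m + 1) i j = (Fin.cons i j : Fin (m + 1) → Fin n) := by
    funext t
    refine Fin.cases ?_ (fun s => ?_) t <;> simp [consVec]
  rw [h, Fin.cons_injective_iff, and_comm]
  simp

theorem adjTG_nonneg {n m : ℕ} (E : Finset (Finset (Fin n))) (v : Fin m → Fin n) :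
    0 ≤ adjTG n m E v := by
  unfold adjTG
  split_ifs <;> positivity

theorem injective_of_adjTG_ne_zero {n m : ℕ} {E : Finset (Finset (Fin n))} {v : Fin m → Fin n}
    (h : adjTG n m E v ≠ 0) : Function.Injective v := by
  by_contra hv
  exact h (if_neg fun hc => hv (List.nodup_ofFn.1 hc.1))

theorem adjTG_pos_of_injective {n m : ℕ} {E : Finset (Finset (Fin n))}
    (hcomp : ∀ A : Finset (Fin n), A.card = m → A ∈ E) {v : Fin m → Fin n}
    (hv : Function.Injective v) : 0 < adjTG n m E v := by
  have hnd : (List.ofFn v).Nodup := List.nodup_ofFn.2 hv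
  have hmem : (List.ofFn v).toFinset ∈ E :=
    hcomp _ (by rw [List.toFinset_card_of_nodup hnd, List.length_ofFn])
  rw [adjTG, if_pos ⟨hnd, hmem⟩]
  positivity

/-- In an m-complete m-graph (2 ≤ m ≤ n), every Z-eigenpair (λ, x) of A_H with
λ > 0 and x nonnegative has all coordinates of x strictly positive. -/
theorem stmt7 (n m : ℕ) (hm : 2 ≤ m) (hmn : m ≤ n) (E : Finset (Finset (Fin n)))
    (hE : ∀ e ∈ E, e.card = m) (hcomp : ∀ A : Finset (Fin n), A.card = m → A ∈ E)
    (lam : ℝ) (x : Fin n → ℝ) (hlam : 0 < lam) (hx : ∀ i, 0 ≤ x i)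
    (heig : ∀ i, tContract (adjTG n m E) x i = lam * x i)
    (hnorm : ∑ i, (x i) ^ 2 = 1) :
    ∀ i, 0 < x i := by
  intro k
  by_contra hk
  have hk0 : x k = 0 := le_antisymm (not_lt.1 hk) (hx k)
  obtain ⟨i, hi⟩ : ∃ i, x i ≠ 0 := by
    by_contra! h
    simp [h] at hnorm
  have hsum : tContract (adjTG n m E) x i ≠ 0 := by
    rw [heig]
    exact mul_ne_zero hlam.ne' hi
  obtain ⟨j, -, hj⟩ := Finset.exists_ne_zero_of_sum_ne_zero hsum
  have hprod : ∏ t, x (j t) ≠ 0 := right_ne_zero_of_mul hj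
  have hinj := injective_of_adjTG_ne_zero (left_ne_zero_of_mul hj)
  rw [consVec_injective_iff (by omega)] at hinj
  have hjk : ∀ t, j t ≠ k := fun t ht =>
    Finset.prod_ne_zero_iff.1 hprod t (Finset.mem_univ t) (by rw [ht, hk0])
  have hpos : 0 < adjTG n m E (consVec k j) * ∏ t, x (j t) :=
    mul_pos (adjTG_pos_of_injective hcomp ((consVec_injective_iff (by omega) k j).2
      ⟨hinj.1, hjk⟩)) ((Finset.prod_nonneg fun t _ => hx _).lt_of_ne' hprod)
  have hle : adjTG n m E (consVec k j) * ∏ t, x (j t) ≤ tContract (adjTG n m E) x k :=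
    Finset.single_le_sum
      (f := fun j : Fin (m - 1) → Fin n => adjTG n m E (consVec k j) * ∏ t, x (j t))
      (fun _ _ => mul_nonneg (adjTG_nonneg _ _) (Finset.prod_nonneg fun t _ => hx _))
      (Finset.mem_univ j)
  rw [heig, hk0, mul_zero] at hle
  exact absurd hpos (not_lt.2 hle)
end
end

section
/- Let H be an m-partite m-graph on n vertices with m even. If λ ∈ ℂ is an E-eigenvalue of the adjacency tensor A_H, then -λ is also an E-eigenvalue of A_H. -/
open Finset

noncomputable section

theorem prod_consVec {M : Type*} [CommMonoid M] {n m : ℕ} (hm : m ≠ 0) (f : Fin n → M)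
    (i : Fin n) (j : Fin (m - 1) → Fin n) :
    ∏ t, f (consVec i j t : Fin n) = f i * ∏ t, f (j t) := by
  obtain ⟨k, rfl⟩ := Nat.exists_eq_succ_of_ne_zero hm
  rw [Fin.prod_univ_succ]
  rfl

theorem prod_eq_prod_toFinset_ofFn {α M : Type*} [DecidableEq α] [CommMonoid M] {m : ℕ}
    (f : α → M) (v : Fin m → α) (hv : (List.ofFn v).Nodup) :
    ∏ t, f (v t) = ∏ a ∈ (List.ofFn v).toFinset, f a := by
  rw [List.prod_toFinset f hv, List.map_ofFn, List.prod_ofFn]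
  rfl

/-- Flipping the sign of a vector on one part of an `m`-partite `m`-graph. -/
theorem tContractC_adjTG_flip {n m : ℕ} (hm : m ≠ 0) (E : Finset (Finset (Fin n)))
    (s : Fin n → ℂ) (hsq : ∀ v, s v * s v = 1) (hs : ∀ e ∈ E, ∏ v ∈ e, s v = -1)
    (x : Fin n → ℂ) (i : Fin n) :
    tContractC (adjTG n m E) (fun v => s v * x v) i =
      -(s i * tContractC (adjTG n m E) x i) := by
  simp only [tContractC, Finset.mul_sum, ← Finset.sum_neg_distrib]
  refine Finset.sum_congr rfl fun j _ => ?_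
  by_cases h : (List.ofFn (consVec i j : Fin m → Fin n)).Nodup ∧
      (List.ofFn (consVec i j : Fin m → Fin n)).toFinset ∈ E
  · have hprod : s i * ∏ t, s (j t) = -1 := by
      rw [← prod_consVec hm, prod_eq_prod_toFinset_ofFn s _ h.1, hs _ h.2]
    have hrest : ∏ t, s (j t) = -s i := by
      linear_combination s i * hprod - (∏ t, s (j t)) * hsq i
    rw [Finset.prod_mul_distrib, hrest]
    ring
  · simp [adjTG, h]

/-- For an m-partite m-graph with m even, if λ is an E-eigenvalue of A_H then
so is -λ.  The m-partition is encoded by a part-assignment P : V → Fin m such that every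
edge contains exactly one vertex from each part. -/
theorem stmt11 (n m : ℕ) (hm : 2 ≤ m) (heven : Even m) (E : Finset (Finset (Fin n)))
    (hE : ∀ e ∈ E, e.card = m) (P : Fin n → Fin m)
    (hpart : ∀ e ∈ E, ∀ p : Fin m, (e.filter (fun v => P v = p)).card = 1)
    (lam : ℂ)
    (hlam : ∃ x : Fin n → ℂ, x ≠ 0 ∧ (∀ i, tContractC (adjTG n m E) x i = lam * x i) ∧
      ∑ i, (x i) ^ 2 = 1) :
    ∃ y : Fin n → ℂ, y ≠ 0 ∧ (∀ i, tContractC (adjTG n m E) y i = (-lam) * y i) ∧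
      ∑ i, (y i) ^ 2 = 1 := by
  obtain ⟨x, hx, heig, hnorm⟩ := hlam
  let s : Fin n → ℂ := fun v => if P v = ⟨0, by omega⟩ then -1 else 1
  have hsq : ∀ v, s v * s v = 1 := fun v => by
    by_cases h : P v = ⟨0, by omega⟩ <;> simp [s, h]
  have hs : ∀ e ∈ E, ∏ v ∈ e, s v = -1 := fun e he => by
    simp [s, Finset.prod_ite, hpart e he]
  refine ⟨fun v => s v * x v, fun h => hx (funext fun v => ?_), fun i => ?_, ?_⟩
  · have hv : s v * x v = 0 := congrFun h v
    show x v = 0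
    linear_combination s v * hv - x v * hsq v
  · rw [tContractC_adjTG_flip (by omega) E s hsq hs, heig]
    ring
  · rw [← hnorm]
    refine Finset.sum_congr rfl fun v _ => ?_
    linear_combination x v ^ 2 * hsq v
end
end
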